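/- arXiv:1703.05434 — 6 statements merged into one kernel-verified Lean document; each statement's English description precedes it below -/
import Mathlib

section
/- Let N ≥ 1, let ω₁,…,ω_N be positive real numbers, let x ∈ ℂ with Re x > 0, and let s ∈ ℂ with Re s > N. Then the function t ↦ t^{s−1}·e^{−xt}·∏_{j=1}^N (1+e^{−ω_j t})^{−1} is integrable on (0,∞), and Γ(s)·ζ_{E,N}(s,x;ω̄) = ∫₀^∞ t^{s−1}·e^{−xt}·∏_{j=1}^N (1+e^{−ω_j t})^{−1} dt, where Γ is the complex Gamma function. -/
open MeasureTheory

/-- The multiple Barnes–Euler zeta function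
`ζ_{E,N}(s,x;ω̄) = ∑_{t̄∈ℕ^N} (−1)^{t₁+⋯+t_N} (x+ω₁t₁+⋯+ω_Nt_N)^{−s}`,
where `z^{−s} = exp(−s·Log z)` is the principal complex power. -/
noncomputable def zetaE (N : ℕ) (ω : Fin N → ℝ) (x s : ℂ) : ℂ :=
  ∑' t : Fin N → ℕ, (-1 : ℂ) ^ (∑ i, t i) * (x + ∑ i, (ω i : ℂ) * (t i : ℂ)) ^ (-s)

lemma hasSum_prod_pi_aux (N : ℕ) (f : Fin N → ℕ → ℂ) (hf : ∀ i, Summable fun n => ‖f i n‖) :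
    (Summable fun t : Fin N → ℕ => ‖∏ i, f i (t i)‖) ∧
    HasSum (fun t : Fin N → ℕ => ∏ i, f i (t i)) (∏ i, ∑' n, f i n) := by
  induction N with
  | zero =>
    refine ⟨(hasSum_fintype _).summable, ?_⟩
    simpa using hasSum_fintype (fun t : Fin 0 → ℕ => ∏ i, f i (t i))
  | succ N ih =>
    obtain ⟨h1, h2⟩ := ih (fun i => f i.succ) (fun i => hf i.succ)
    have e := Fin.consEquiv (fun _ : Fin (N+1) => ℕ)
    have key : ∀ p : ℕ × (Fin N → ℕ), ∏ i, f i ((Fin.consEquiv (fun _ : Fin (N+1) => ℕ)) p i)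
        = f 0 p.1 * ∏ i, f i.succ (p.2 i) := by
      intro p
      rw [Fin.prod_univ_succ]
      simp [Fin.consEquiv]
    have hn := (hf 0).mul_norm h1
    constructor
    · rw [← (Fin.consEquiv (fun _ : Fin (N+1) => ℕ)).summable_iff]
      refine hn.congr fun p => ?_
      simp only [Function.comp_apply]
      rw [key p]
    · rw [← (Fin.consEquiv (fun _ : Fin (N+1) => ℕ)).hasSum_iff, Fin.prod_univ_succ]
      have := (hf 0).of_norm.hasSum.mul h2 hn.of_norm
      refine this.congr_fun fun p => ?_
      simp only [Function.comp_apply]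
      rw [key p]

lemma summable_pow_aux (N : ℕ) (hN : 1 ≤ N) (ω : Fin N → ℝ) (hω : ∀ i, 0 < ω i)
    (a : ℝ) (ha : 0 < a) (σ : ℝ) (hs : (N : ℝ) < σ) :
    Summable fun t : Fin N → ℕ => (a + ∑ i, ω i * (t i : ℝ)) ^ (-σ) := by
  have hN0 : (0 : ℝ) < N := by exact_mod_cast hN
  have hp : 1 < σ / N := by rwa [one_lt_div hN0]
  set δ : Fin N → ℝ := fun i => min a (ω i) with hδ
  have hδ0 : ∀ i, 0 < δ i := fun i => lt_min ha (hω i)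
  have hbase : Summable fun n : ℕ => ((n : ℝ) + 1) ^ (-(σ / N)) := by
    have := (Real.summable_nat_rpow (p := -(σ / N))).2 (by linarith)
    simpa using (summable_nat_add_iff 1).2 this
  have h := (hasSum_prod_pi_aux N
    (fun i n => (((δ i * ((n : ℝ) + 1)) ^ (-(σ / N)) : ℝ) : ℂ)) (fun i => by
      refine (hbase.mul_left ((δ i) ^ (-(σ / N)))).congr fun n => ?_
      have : 0 ≤ (δ i * ((n : ℝ) + 1)) := mul_nonneg (hδ0 i).le (by positivity)
      rw [Complex.norm_real, Real.norm_of_nonneg (Real.rpow_nonneg this _),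
        Real.mul_rpow (hδ0 i).le (by positivity)])).1
  refine Summable.of_nonneg_of_le (fun t => ?_) (fun t => ?_) h
  · exact Real.rpow_nonneg (add_nonneg ha.le
      (Finset.sum_nonneg fun i _ => mul_nonneg (hω i).le (Nat.cast_nonneg _))) _
  · have hA : ∀ i, δ i * ((t i : ℝ) + 1) ≤ a + ∑ i, ω i * (t i : ℝ) := by
      intro i
      have h1 : ω i * (t i : ℝ) ≤ ∑ i, ω i * (t i : ℝ) :=
        Finset.single_le_sum (f := fun i => ω i * (t i : ℝ))
          (fun i _ => mul_nonneg (hω i).le (Nat.cast_nonneg _)) (Finset.mem_univ i)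
      have h2 : δ i * (t i : ℝ) ≤ ω i * (t i : ℝ) :=
        mul_le_mul_of_nonneg_right (min_le_right _ _) (Nat.cast_nonneg _)
      have h3 : δ i ≤ a := min_le_left _ _
      linarith
    have hA0 : 0 < a + ∑ i, ω i * (t i : ℝ) := add_pos_of_pos_of_nonneg ha
      (Finset.sum_nonneg fun i _ => mul_nonneg (hω i).le (Nat.cast_nonneg _))
    rw [← Complex.ofReal_prod, Complex.norm_real, Real.norm_of_nonneg]
    · calc (a + ∑ i, ω i * (t i : ℝ)) ^ (-σ)
          = ∏ _i : Fin N, (a + ∑ i, ω i * (t i : ℝ)) ^ (-(σ / N)) := by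
            rw [Finset.prod_const, ← Real.rpow_natCast, ← Real.rpow_mul hA0.le]
            congr 1
            simp
            field_simp
        _ ≤ _ := by
            refine Finset.prod_le_prod (fun i _ => Real.rpow_nonneg hA0.le _) fun i _ => ?_
            exact Real.rpow_le_rpow_of_nonpos (mul_pos (hδ0 i) (by positivity)) (hA i)
              (by linarith)
    · exact Finset.prod_nonneg fun i _ =>
        Real.rpow_nonneg (mul_nonneg (hδ0 i).le (by positivity)) _

lemma norm_aux (s z : ℂ) (t : ℝ) (ht : 0 < t) :
    ‖(t : ℂ) ^ (s - 1) * Complex.exp (-z * t)‖ = t ^ (s.re - 1) * Real.exp (-z.re * t) := by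
  rw [norm_mul, Complex.norm_cpow_eq_rpow_re_of_pos ht, Complex.norm_exp]
  simp

lemma real_integrable_aux (σ r : ℝ) (hσ : 0 < σ) (hr : 0 < r) :
    IntegrableOn (fun t : ℝ => t ^ (σ - 1) * Real.exp (-r * t)) (Set.Ioi 0) := by
  have := integrableOn_rpow_mul_exp_neg_mul_rpow (p := 1) (s := σ - 1) (b := r) (by linarith)
    one_pos hr
  simpa using this

lemma meas_aux (s z : ℂ) :
    Measurable fun t : ℝ => (t : ℂ) ^ (s - 1) * Complex.exp (-z * t) := by
  fun_prop

lemma integrable_aux (s z : ℂ) (hs : 0 < s.re) (hz : 0 < z.re) :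
    IntegrableOn (fun t : ℝ => (t : ℂ) ^ (s - 1) * Complex.exp (-z * t)) (Set.Ioi 0) := by
  refine (real_integrable_aux s.re z.re hs hz).mono' (meas_aux s z).aestronglyMeasurable ?_
  refine (ae_restrict_iff' measurableSet_Ioi).2 (Filter.Eventually.of_forall fun t ht => ?_)
  exact (norm_aux s z t ht).le

lemma deriv_aux (s z : ℂ) (hs : 0 < s.re) (hz : 0 < z.re) :
    DifferentiableAt ℂ
      (fun z : ℂ => ∫ t in Set.Ioi (0:ℝ), (t : ℂ) ^ (s - 1) * Complex.exp (-z * t)) z := by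
  have hball : ∀ w ∈ Metric.ball z (z.re / 2), z.re / 2 ≤ w.re := by
    intro w hw
    have h1 : |(w - z).re| < z.re / 2 :=
      (Complex.abs_re_le_norm _).trans_lt (by simpa [dist_eq_norm] using hw)
    have := (abs_lt.1 h1).1
    simp at this
    linarith
  refine (hasDerivAt_integral_of_dominated_loc_of_deriv_le
    (F := fun (z : ℂ) (t : ℝ) => (t : ℂ) ^ (s - 1) * Complex.exp (-z * t))
    (F' := fun (z : ℂ) (t : ℝ) => (t : ℂ) ^ (s - 1) * (Complex.exp (-z * t) * (-t)))
    (bound := fun t : ℝ => t ^ ((s.re + 1) - 1) * Real.exp (-(z.re / 2) * t))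
    (Metric.ball_mem_nhds z (half_pos hz))
    (Filter.Eventually.of_forall fun w => (meas_aux s w).aestronglyMeasurable)
    (integrable_aux s z hs hz) ?_ ?_
    (real_integrable_aux (s.re + 1) (z.re / 2) (by linarith) (half_pos hz)) ?_).2.differentiableAt
  · apply Measurable.aestronglyMeasurable
    fun_prop
  · refine (ae_restrict_iff' measurableSet_Ioi).2 (Filter.Eventually.of_forall fun t ht w hw => ?_)
    have ht : 0 < t := ht
    rw [← mul_assoc, norm_mul, norm_aux s w t ht, norm_neg, Complex.norm_real,
      Real.norm_of_nonneg ht.le]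
    have : t ^ ((s.re + 1) - 1) = t ^ (s.re - 1) * t := by
      rw [← Real.rpow_add_one ht.ne']; congr 1; ring
    rw [this, mul_right_comm]
    have := hball w hw
    gcongr
  · refine Filter.Eventually.of_forall fun t w hw => ?_
    have h : HasDerivAt (fun w : ℂ => -w * t) (-t) w := by
      simpa using (hasDerivAt_id w).neg.mul_const (t : ℂ)
    exact (h.cexp).const_mul _

lemma gamma_aux (s z : ℂ) (hs : 0 < s.re) (hz : 0 < z.re) :
    ∫ t in Set.Ioi (0:ℝ), (t : ℂ) ^ (s - 1) * Complex.exp (-z * t) = Complex.Gamma s * z ^ (-s) := by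
  have hopen : IsOpen {z : ℂ | 0 < z.re} := isOpen_lt continuous_const Complex.continuous_re
  have hconv : Convex ℝ {z : ℂ | 0 < z.re} := convex_halfSpace_re_gt 0
  have hf : AnalyticOnNhd ℂ
      (fun z : ℂ => ∫ t in Set.Ioi (0:ℝ), (t : ℂ) ^ (s - 1) * Complex.exp (-z * t))
      {z : ℂ | 0 < z.re} :=
    DifferentiableOn.analyticOnNhd
      (fun w hw => (deriv_aux s w hs hw).differentiableWithinAt) hopen
  have hg : AnalyticOnNhd ℂ (fun z : ℂ => Complex.Gamma s * z ^ (-s)) {z : ℂ | 0 < z.re} := by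
    refine DifferentiableOn.analyticOnNhd (fun w hw => ?_) hopen
    have : w ∈ Complex.slitPlane := Or.inl hw
    exact ((differentiableAt_id.cpow_const this).const_mul _).differentiableWithinAt
  refine hf.eqOn_of_preconnected_of_frequently_eq hg hconv.isPreconnected
    (z₀ := 1) (by simp) ?_ hz
  have hreal : ∀ r : ℝ, 0 < r →
      ∫ t in Set.Ioi (0:ℝ), (t : ℂ) ^ (s - 1) * Complex.exp (-(r:ℂ) * t)
        = Complex.Gamma s * (r : ℂ) ^ (-s) := by
    intro r hr
    have := Complex.integral_cpow_mul_exp_neg_mul_Ioi hs hr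
    simp_rw [← neg_mul] at this
    rw [this, one_div, Complex.inv_cpow _ _ (Complex.arg_ofReal_of_nonneg hr.le ▸ Real.pi_pos.ne),
      Complex.cpow_neg, mul_comm]
  have ht : Filter.Tendsto (fun n : ℕ => (((1 + 1 / ((n : ℝ) + 1) : ℝ)) : ℂ)) Filter.atTop
      (nhdsWithin 1 {1}ᶜ) := by
    refine tendsto_nhdsWithin_iff.2 ⟨?_, Filter.Eventually.of_forall fun n => ?_⟩
    · have h := (tendsto_one_div_add_atTop_nhds_zero_nat (𝕜 := ℝ)).const_add 1
      rw [add_zero] at h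
      have h2 := (Complex.continuous_ofReal.tendsto _).comp h
      rw [Complex.ofReal_one] at h2
      exact h2
    · have : (0:ℝ) < 1 / ((n : ℝ) + 1) := by positivity
      intro h
      have h' : (1 + 1 / ((n : ℝ) + 1) : ℝ) = 1 := by
        have h3 := Set.mem_singleton_iff.1 h
        exact_mod_cast h3
      linarith
  exact ht.frequently (Filter.Frequently.of_forall fun n => hreal _ (by positivity))

lemma geom_aux (N : ℕ) (ω : Fin N → ℝ) (hω : ∀ i, 0 < ω i) (x s : ℂ) (u : ℝ) (hu : 0 < u) :
    HasSum (fun t : Fin N → ℕ => (-1 : ℂ) ^ (∑ i, t i) *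
        ((u : ℂ) ^ (s - 1) * Complex.exp (-(x + ∑ i, (ω i : ℂ) * (t i : ℂ)) * u)))
      ((u : ℂ) ^ (s - 1) * Complex.exp (-x * u) *
          ∏ j, (1 + Complex.exp (-(ω j : ℂ) * u))⁻¹) := by
  have hn : ∀ i, ‖-Complex.exp (-(ω i : ℂ) * u)‖ < 1 := by
    intro i
    rw [norm_neg, Complex.norm_exp]
    simpa using mul_pos (hω i) hu
  have h := (hasSum_prod_pi_aux N (fun i n => (-Complex.exp (-(ω i : ℂ) * u)) ^ n) (fun i => by
    simp_rw [norm_pow]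
    exact summable_geometric_of_lt_one (norm_nonneg _) (hn i))).2
  simp_rw [tsum_geometric_of_norm_lt_one (hn _), sub_neg_eq_add] at h
  refine (h.mul_left ((u : ℂ) ^ (s - 1) * Complex.exp (-x * u))).congr_fun fun t => ?_
  have h1 : Complex.exp (-(x + ∑ i, (ω i : ℂ) * (t i : ℂ)) * u) =
      Complex.exp (-x * u) * ∏ i, Complex.exp (-(ω i : ℂ) * u) ^ t i := by
    simp_rw [← Complex.exp_nat_mul]
    rw [← Complex.exp_sum, ← Complex.exp_add, neg_add, add_mul, ← Finset.sum_neg_distrib,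
      Finset.sum_mul]
    congr 2
    exact Finset.sum_congr rfl fun i _ => by ring
  simp_rw [neg_pow (Complex.exp _)]
  rw [h1, Finset.prod_mul_distrib, Finset.prod_pow_eq_pow_sum]
  ring

theorem stmt1 (N : ℕ) (hN : 1 ≤ N) (ω : Fin N → ℝ) (hω : ∀ i, 0 < ω i)
    (x : ℂ) (hx : 0 < x.re) (s : ℂ) (hs : (N : ℝ) < s.re) :
    IntegrableOn (fun t : ℝ =>
        (t : ℂ) ^ (s - 1) * Complex.exp (-x * t) *
          ∏ j, (1 + Complex.exp (-(ω j : ℂ) * t))⁻¹) (Set.Ioi (0 : ℝ)) ∧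
    Complex.Gamma s * zetaE N ω x s =
      ∫ t in Set.Ioi (0 : ℝ),
        (t : ℂ) ^ (s - 1) * Complex.exp (-x * t) *
          ∏ j, (1 + Complex.exp (-(ω j : ℂ) * t))⁻¹ := by
  have hs0 : 0 < s.re := lt_of_le_of_lt (Nat.cast_nonneg N) hs
  constructor
  · refine (real_integrable_aux s.re x.re hs0 hx).mono'
      (Measurable.aestronglyMeasurable (by fun_prop)) ?_
    refine (ae_restrict_iff' measurableSet_Ioi).2 (Filter.Eventually.of_forall fun t ht => ?_)
    rw [norm_mul, norm_aux s x t ht]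
    refine mul_le_of_le_one_right
      (mul_nonneg (Real.rpow_nonneg (le_of_lt ht) _) (Real.exp_pos _).le) ?_
    rw [norm_prod]
    refine Finset.prod_le_one (fun i _ => norm_nonneg _) fun i _ => ?_
    rw [norm_inv]
    refine inv_le_one_of_one_le₀ ?_
    have : (1 + Complex.exp (-(ω i : ℂ) * t)) = ((1 + Real.exp (-(ω i) * t) : ℝ) : ℂ) := by
      push_cast; rfl
    have h0 := Real.exp_pos (-(ω i) * t)
    rw [this, Complex.norm_real, Real.norm_of_nonneg (by linarith)]
    linarith
  · have hre : ∀ t : Fin N → ℕ, (x + ∑ i, (ω i : ℂ) * (t i : ℂ)).re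
        = x.re + ∑ i, ω i * (t i : ℝ) := by
      intro t
      simp
    have hpos : ∀ t : Fin N → ℕ, 0 < (x + ∑ i, (ω i : ℂ) * (t i : ℂ)).re := by
      intro t
      rw [hre]
      exact add_pos_of_pos_of_nonneg hx
        (Finset.sum_nonneg fun i _ => mul_nonneg (hω i).le (Nat.cast_nonneg _))
    have H := hasSum_integral_of_summable_integral_norm
      (μ := volume.restrict (Set.Ioi (0:ℝ)))
      (F := fun (t : Fin N → ℕ) (u : ℝ) => (-1 : ℂ) ^ (∑ i, t i) *
        ((u : ℂ) ^ (s - 1) * Complex.exp (-(x + ∑ i, (ω i : ℂ) * (t i : ℂ)) * u)))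
      (fun t => (integrable_aux s _ hs0 (hpos t)).const_mul _) (by
        refine ((summable_pow_aux N hN ω hω x.re hx s.re hs).mul_left
          (Real.Gamma s.re)).congr fun t => ?_
        have hp := hpos t
        rw [← hre]
        have := Real.integral_rpow_mul_exp_neg_mul_Ioi hs0 hp
        rw [Real.rpow_neg hp.le, ← Real.inv_rpow hp.le, ← one_div, mul_comm, ← this]
        refine setIntegral_congr_fun measurableSet_Ioi fun u hu => ?_
        rw [norm_mul, norm_aux s _ u hu]
        rw [norm_pow, norm_neg, norm_one, one_pow, one_mul, neg_mul])
    rw [setIntegral_congr_fun measurableSet_Ioi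
      (fun u hu => (geom_aux N ω hω x s u hu).tsum_eq)] at H
    rw [← H.tsum_eq, zetaE, ← tsum_mul_left]
    refine tsum_congr fun t => ?_
    rw [integral_const_mul, gamma_aux s _ hs0 (hpos t)]
    ring
end

section
/- Let N ≥ 1, let ω₁,…,ω_N be positive real numbers, let x ∈ ℂ with Re x > 0, and let s ∈ ℂ with Re s > N. Then ζ_{E,N}(s, x+ω_N; ω₁,…,ω_N) + ζ_{E,N}(s, x; ω₁,…,ω_N) = ζ_{E,N−1}(s, x; ω₁,…,ω_{N−1}). -/
theorem aux_pi_summable : ∀ (n : ℕ) (f : Fin n → ℕ → ℝ), (∀ i k, 0 ≤ f i k) →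
    (∀ i, Summable (f i)) → Summable fun t : Fin n → ℕ => ∏ i, f i (t i) := by
  intro n
  induction n with
  | zero => intro f _ _; exact Summable.of_finite
  | succ n ih =>
    intro f h0 hf
    rw [← (Fin.snocEquiv (fun _ : Fin (n + 1) => ℕ)).summable_iff]
    have h1 := ih (fun i => f i.castSucc) (fun i => h0 _) (fun i => hf _)
    have h2 := (hf (Fin.last n)).mul_of_nonneg h1 (fun k => h0 _ k)
      (fun t => Finset.prod_nonneg fun i _ => h0 _ _)
    refine h2.congr fun p => ?_
    simp [Fin.prod_univ_castSucc, Fin.snocEquiv, mul_comm]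

theorem aux_one (a w p : ℝ) (ha : 0 < a) (hw : 0 < w) (hp : 1 < p) :
    Summable fun k : ℕ => (a + w * k) ^ (-p) := by
  have h := ((Real.summable_one_div_nat_add_rpow (a / w) p).2 hp).mul_left (w ^ (-p))
  refine h.congr fun k => ?_
  have hk : 0 < (k : ℝ) + a / w := by positivity
  rw [abs_of_pos hk, one_div, ← Real.rpow_neg hk.le, ← Real.mul_rpow hw.le hk.le]
  congr 1
  field_simp
  ring

theorem aux_summable (N : ℕ) (ω : Fin (N + 1) → ℝ) (hω : ∀ i, 0 < ω i)
    (x : ℂ) (hx : 0 < x.re) (s : ℂ) (hs : ((N + 1 : ℕ) : ℝ) < s.re) :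
    Summable fun t : Fin (N + 1) → ℕ =>
      (-1 : ℂ) ^ (∑ i, t i) * (x + ∑ i, (ω i : ℂ) * (t i : ℂ)) ^ (-s) := by
  have hN : (0 : ℝ) < ((N + 1 : ℕ) : ℝ) := by positivity
  set p : ℝ := s.re / ((N + 1 : ℕ) : ℝ) with hp
  have hp1 : 1 < p := by rw [hp, lt_div_iff₀ hN]; linarith
  have hS := (aux_pi_summable (N + 1) (fun i k => (x.re + ω i * k) ^ (-p))
    (fun i k => by have := hω i; positivity)
    (fun i => aux_one _ _ _ hx (hω i) hp1)).mul_left (Real.exp (Real.pi * |s.im|))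
  refine Summable.of_norm_bounded hS fun t => ?_
  set z : ℂ := x + ∑ i, (ω i : ℂ) * (t i : ℂ) with hz
  have hzre : z.re = x.re + ∑ i, ω i * (t i : ℝ) := by simp [hz]
  have hle : ∀ i, x.re + ω i * (t i : ℝ) ≤ z.re := by
    intro i
    rw [hzre]
    have := Finset.single_le_sum (f := fun i => ω i * (t i : ℝ))
      (fun i _ => mul_nonneg (hω i).le (Nat.cast_nonneg _)) (Finset.mem_univ i)
    simpa using this
  have hpos : ∀ i, 0 < x.re + ω i * (t i : ℝ) := fun i => by have := hω i; positivity
  have hzn : ∀ i, x.re + ω i * (t i : ℝ) ≤ ‖z‖ := fun i => (hle i).trans (Complex.re_le_norm z)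
  have hz0 : 0 < ‖z‖ := (hpos 0).trans_le (hzn 0)
  rw [norm_mul, norm_pow, norm_neg, norm_one, one_pow, one_mul]
  refine (Complex.norm_cpow_le z (-s)).trans ?_
  rw [div_eq_mul_inv, ← Real.exp_neg, mul_comm]
  refine mul_le_mul ?_ ?_ (by positivity) (by positivity)
  · rw [Real.exp_le_exp]
    have : -(z.arg * (-s).im) = z.arg * s.im := by simp
    rw [this]
    calc _ ≤ |z.arg * s.im| := le_abs_self _
      _ = |z.arg| * |s.im| := abs_mul _ _
      _ ≤ _ := by gcongr; exact Complex.abs_arg_le_pi z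
  · have e : ‖z‖ ^ (-s).re = ∏ i : Fin (N + 1), ‖z‖ ^ (-p) := by
      rw [Finset.prod_const, Finset.card_univ, Fintype.card_fin, ← Real.rpow_natCast,
        ← Real.rpow_mul hz0.le]
      congr 1
      rw [hp, Complex.neg_re]
      field_simp
    rw [e]
    refine Finset.prod_le_prod (fun i _ => by positivity) fun i _ => ?_
    exact Real.rpow_le_rpow_of_nonpos (hpos i) (hzn i) (by linarith)

theorem aux_iter (N : ℕ) (ω : Fin (N + 1) → ℝ) (hω : ∀ i, 0 < ω i)
    (x : ℂ) (hx : 0 < x.re) (s : ℂ) (hs : ((N + 1 : ℕ) : ℝ) < s.re) :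
    HasSum (fun k : ℕ => (-1 : ℂ) ^ k *
      zetaE N (fun i => ω i.castSucc) (x + (ω (Fin.last N) : ℂ) * k) s)
      (zetaE (N + 1) ω x s) := by
  have h := (aux_summable N ω hω x hx s hs).hasSum
  rw [← (Fin.snocEquiv (fun _ : Fin (N + 1) => ℕ)).hasSum_iff] at h
  have h2 := h.prod_fiberwise fun k => (h.summable.prod_factor k).hasSum
  unfold zetaE
  convert h2 using 2 with k
  rw [← tsum_mul_left]
  refine tsum_congr fun t => ?_
  simp only [Function.comp, Fin.snocEquiv, Equiv.coe_fn_mk, Fin.sum_univ_castSucc,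
    Fin.snoc_castSucc, Fin.snoc_last, pow_add]
  rw [add_assoc, add_comm ((ω (Fin.last N) : ℂ) * k)]
  ring

/-- The difference equation
`ζ_{E,N}(s, x+ω_N; ω₁,…,ω_N) + ζ_{E,N}(s, x; ω₁,…,ω_N) = ζ_{E,N−1}(s, x; ω₁,…,ω_{N−1})`
for `N ≥ 1` (here the index `N` of the statement is `N+1`). -/
theorem stmt2 (N : ℕ) (ω : Fin (N + 1) → ℝ) (hω : ∀ i, 0 < ω i)
    (x : ℂ) (hx : 0 < x.re) (s : ℂ) (hs : ((N + 1 : ℕ) : ℝ) < s.re) :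
    zetaE (N + 1) ω (x + (ω (Fin.last N) : ℂ)) s + zetaE (N + 1) ω x s =
      zetaE N (fun i => ω i.castSucc) x s := by
  have h1 := aux_iter N ω hω x hx s hs
  have h2 := aux_iter N ω hω (x + (ω (Fin.last N) : ℂ))
    (by simpa using add_pos hx (hω _)) s hs
  have h3 := h1.summable.tsum_eq_zero_add
  rw [h1.tsum_eq] at h3
  rw [h3, ← h2.tsum_eq]
  have h4 : ∀ k : ℕ, (-1 : ℂ) ^ (k + 1) * zetaE N (fun i => ω i.castSucc)
      (x + (ω (Fin.last N) : ℂ) * ((k + 1 : ℕ) : ℂ)) s =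
      -((-1 : ℂ) ^ k * zetaE N (fun i => ω i.castSucc)
      (x + (ω (Fin.last N) : ℂ) + (ω (Fin.last N) : ℂ) * k) s) := by
    intro k
    have : x + (ω (Fin.last N) : ℂ) * ((k + 1 : ℕ) : ℂ) =
      x + (ω (Fin.last N) : ℂ) + (ω (Fin.last N) : ℂ) * k := by push_cast; ring
    rw [this, pow_succ]
    ring
  rw [tsum_congr h4, tsum_neg]
  simp
end

section
/- Let A be a commutative ℚ-algebra, let K ∈ ℕ, let x, ω₁,…,ω_{K+1} ∈ A, let n ∈ ℕ, and let M be a positive odd integer. Then ∑_{j=0}^{M−1} (−1)^j·E_{K,n+1}(x + j·ω_{K+1}; ω₁,…,ω_K) = (1/2)·(E_{K+1,n+1}(x; ω₁,…,ω_{K+1}) + E_{K+1,n+1}(x + M·ω_{K+1}; ω₁,…,ω_{K+1})). -/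
noncomputable def twoUnit (A : Type*) [CommRing A] [Algebra ℚ A] : Aˣ where
  val := 2
  inv := algebraMap ℚ A (1 / 2)
  val_inv := by
    rw [show (2 : A) = algebraMap ℚ A 2 from (map_ofNat (algebraMap ℚ A) 2).symm, ← map_mul]
    norm_num
  inv_val := by
    rw [show (2 : A) = algebraMap ℚ A 2 from (map_ofNat (algebraMap ℚ A) 2).symm, ← map_mul]
    norm_num

/-- Higher-order Euler polynomial `E_{N,n}(x; ω)`, defined via the generating-function
identity `∑_{n≥0} E_{N,n}(x;ω)·Tⁿ/n! = 2^N·exp(xT)·∏_{j=1}^N (exp(ωⱼT)+1)⁻¹` in `A⟦T⟧`,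
where each factor `exp(ωⱼT)+1` is invertible since its constant term is `2`. -/
noncomputable def eulerHO (A : Type*) [CommRing A] [Algebra ℚ A]
    (N : ℕ) (ω : Fin N → A) (x : A) (n : ℕ) : A :=
  (n.factorial : A) * PowerSeries.coeff (R := A) n
    ((2 : A) ^ N • (PowerSeries.rescale x (PowerSeries.exp A) *
      ∏ j : Fin N,
        PowerSeries.invOfUnit (PowerSeries.rescale (ω j) (PowerSeries.exp A) + 1) (twoUnit A)))

theorem eulerHO_step (A : Type*) [CommRing A] [Algebra ℚ A] (K : ℕ) (ω : Fin (K + 1) → A)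
    (y : A) (n : ℕ) :
    eulerHO A (K + 1) ω y n + eulerHO A (K + 1) ω (y + ω (Fin.last K)) n =
      2 * eulerHO A K (fun i => ω i.castSucc) y n := by
  have hinv : (PowerSeries.rescale (ω (Fin.last K)) (PowerSeries.exp A) + 1) *
      PowerSeries.invOfUnit (PowerSeries.rescale (ω (Fin.last K)) (PowerSeries.exp A) + 1)
        (twoUnit A) = 1 := by
    apply PowerSeries.mul_invOfUnit
    rw [← PowerSeries.coeff_zero_eq_constantCoeff_apply, map_add, PowerSeries.coeff_rescale]
    simp [twoUnit]
    norm_num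
  unfold eulerHO
  rw [← mul_add, ← map_add, ← smul_add, ← PowerSeries.exp_mul_exp_eq_exp_add,
    Fin.prod_univ_castSucc]
  generalize PowerSeries.invOfUnit (PowerSeries.rescale (ω (Fin.last K)) (PowerSeries.exp A) + 1)
        (twoUnit A) = I at *
  generalize PowerSeries.rescale (ω (Fin.last K)) (PowerSeries.exp A) = W at *
  generalize PowerSeries.rescale y (PowerSeries.exp A) = Y at *
  generalize ∏ j : Fin K, PowerSeries.invOfUnit
    (PowerSeries.rescale (ω j.castSucc) (PowerSeries.exp A) + 1) (twoUnit A) = P at *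
  have h : Y * (P * I) + Y * W * (P * I) = Y * P := by
    linear_combination (Y * P) * hinv
  rw [h, PowerSeries.coeff_smul, PowerSeries.coeff_smul]
  simp only [smul_eq_mul]
  ring

/-- For a commutative `ℚ`-algebra `A`, `x, ω₁,…,ω_{K+1} ∈ A`, `n ∈ ℕ` and
a positive odd integer `M`,
`∑_{j=0}^{M−1} (−1)^j E_{K,n+1}(x + j·ω_{K+1}; ω₁,…,ω_K)
  = (1/2)·(E_{K+1,n+1}(x; ω₁,…,ω_{K+1}) + E_{K+1,n+1}(x + M·ω_{K+1}; ω₁,…,ω_{K+1}))`. -/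
theorem stmt6 (A : Type*) [CommRing A] [Algebra ℚ A] (K : ℕ) (ω : Fin (K + 1) → A)
    (x : A) (n : ℕ) (M : ℕ) (hM : 0 < M) (hMo : Odd M) :
    ∑ j ∈ Finset.range M, (-1 : A) ^ j *
        eulerHO A K (fun i => ω i.castSucc) (x + (j : A) * ω (Fin.last K)) (n + 1) =
      algebraMap ℚ A (1 / 2) *
        (eulerHO A (K + 1) ω x (n + 1) +
          eulerHO A (K + 1) ω (x + (M : A) * ω (Fin.last K)) (n + 1)) := by
  have h2 : algebraMap ℚ A (1 / 2) * 2 = 1 := (twoUnit A).inv_val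
  have key : ∀ M : ℕ, ∑ j ∈ Finset.range M, (-1 : A) ^ j *
        eulerHO A K (fun i => ω i.castSucc) (x + (j : A) * ω (Fin.last K)) (n + 1) =
      algebraMap ℚ A (1 / 2) *
        (eulerHO A (K + 1) ω x (n + 1) - (-1) ^ M *
          eulerHO A (K + 1) ω (x + (M : A) * ω (Fin.last K)) (n + 1)) := by
    intro M
    induction M with
    | zero => simp
    | succ m ih =>
      have hs := eulerHO_step A K ω (x + (m : A) * ω (Fin.last K)) (n + 1)
      have he : x + ((m + 1 : ℕ) : A) * ω (Fin.last K)
          = x + (m : A) * ω (Fin.last K) + ω (Fin.last K) := by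
        push_cast; ring
      rw [Finset.sum_range_succ, ih, he]
      linear_combination (-(-1) ^ m * algebraMap ℚ A (1 / 2)) * hs -
        ((-1) ^ m * eulerHO A K (fun i => ω i.castSucc)
          (x + (m : A) * ω (Fin.last K)) (n + 1)) * h2
  rw [key M, hMo.neg_one_pow]
  ring
end

section
/- Let p be an odd prime and K as below, and let f : ℤ_p → K be continuous. Then the sequence l ↦ ∑_{a=0}^{p^l−1} (−1)^a·f(a), where a ∈ ℕ is viewed as an element of ℤ_p, converges in K (i.e. the fermionic p-adic integral of f exists). -/
theorem aux_block {K : Type*} [NormedField K] [IsUltrametricDist K] (g : ℕ → K) (N : ℕ)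
    (hN : Odd N) (ε : ℝ) (hε : 0 ≤ ε) (h : ∀ a b : ℕ, ‖g (N * b + a) - g a‖ ≤ ε) (m : ℕ) :
    ‖∑ a ∈ Finset.range (N * m), (-1 : K) ^ a * g a
      - (∑ b ∈ Finset.range m, (-1 : K) ^ b) * ∑ a ∈ Finset.range N, (-1 : K) ^ a * g a‖ ≤ ε := by
  induction m with
  | zero => simpa using hε
  | succ m ih =>
    have e : ∑ a ∈ Finset.range (N * (m + 1)), (-1 : K) ^ a * g a
      - (∑ b ∈ Finset.range (m + 1), (-1 : K) ^ b) * ∑ a ∈ Finset.range N, (-1 : K) ^ a * g a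
      = (∑ a ∈ Finset.range (N * m), (-1 : K) ^ a * g a
      - (∑ b ∈ Finset.range m, (-1 : K) ^ b) * ∑ a ∈ Finset.range N, (-1 : K) ^ a * g a)
      + ∑ a ∈ Finset.range N, (-1 : K) ^ (m + a) * (g (N * m + a) - g a) := by
      rw [mul_add, mul_one, Finset.sum_range_add, Finset.sum_range_succ, add_mul, Finset.mul_sum (Finset.range N) _ ((-1 : K) ^ m)]
      simp only [pow_add, pow_mul, hN.neg_one_pow, mul_sub, Finset.sum_sub_distrib, mul_assoc]
      ring
    rw [e]
    refine (IsUltrametricDist.norm_add_le_max _ _).trans (max_le ih ?_)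
    refine IsUltrametricDist.norm_sum_le_of_forall_le_of_nonneg hε fun a _ => ?_
    simpa using h a m

/-- Existence of the fermionic `p`-adic integral: for an odd prime `p`,
a complete nontrivially normed ultrametric field `K` which is a normed `ℚ_[p]`-algebra, and
a continuous `f : ℤ_p → K`, the sequence `l ↦ ∑_{a=0}^{p^l−1} (−1)^a f(a)` converges in `K`. -/
theorem stmt12 (p : ℕ) [Fact p.Prime] (hp : p ≠ 2)
    (K : Type*) [NontriviallyNormedField K] [CompleteSpace K]
    [NormedAlgebra ℚ_[p] K] [IsUltrametricDist K]
    (f : ℤ_[p] → K) (hf : Continuous f) :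
    ∃ L : K, Filter.Tendsto
      (fun l : ℕ => ∑ a ∈ Finset.range (p ^ l), (-1 : K) ^ a * f (a : ℤ_[p]))
      Filter.atTop (nhds L) := by
  have hodd : Odd p := (Fact.out : p.Prime).odd_of_ne_two hp
  have hu : UniformContinuous f := CompactSpace.uniformContinuous_of_continuous hf
  apply cauchySeq_tendsto_of_complete
  rw [Metric.cauchySeq_iff']
  intro ε hε
  obtain ⟨δ, hδ, H⟩ := Metric.uniformContinuous_iff.1 hu (ε / 2) (half_pos hε)
  obtain ⟨l, hl⟩ := PadicInt.exists_pow_neg_lt p hδ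
  refine ⟨l, fun n hn => ?_⟩
  obtain ⟨k, rfl⟩ := Nat.exists_eq_add_of_le hn
  have key := aux_block (fun a : ℕ => f (a : ℤ_[p])) (p ^ l) hodd.pow (ε / 2) (half_pos hε).le
    (fun a b => by
      rw [← dist_eq_norm]
      refine (H ?_).le
      rw [dist_eq_norm]
      push_cast
      rw [add_sub_cancel_right, norm_mul, PadicInt.norm_p_pow]
      refine lt_of_le_of_lt (mul_le_of_le_one_right (by positivity) (PadicInt.norm_le_one _)) hl) (p ^ k)
  rw [neg_one_geom_sum, if_neg (Nat.not_even_iff_odd.2 hodd.pow), one_mul, ← pow_add] at key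
  rw [dist_eq_norm]
  linarith
end

section
/- Let p be an odd prime and K as below, and let f : ℤ_p → K be continuous. Then, as l → ∞, the sums ∑_{a=0}^{p^l−1} (−1)^a·(f(a+1) + f(a)) converge in K to 2·f(0), where a and a+1 are viewed as elements of ℤ_p. (Equivalently, the fermionic p-adic integrals satisfy I_{−1}(f(·+1)) + I_{−1}(f) = 2 f(0).) -/
/-- For an odd prime `p`, a complete nontrivially normed ultrametric
field `K` which is a normed `ℚ_[p]`-algebra, and a continuous `f : ℤ_p → K`, the sums
`∑_{a=0}^{p^l−1} (−1)^a (f(a+1) + f(a))` converge, as `l → ∞`, to `2·f(0)`; i.e. the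
fermionic `p`-adic integrals satisfy `I_{−1}(f(·+1)) + I_{−1}(f) = 2 f(0)`. -/
theorem stmt13 (p : ℕ) [Fact p.Prime] (hp : p ≠ 2)
    (K : Type*) [NontriviallyNormedField K] [CompleteSpace K]
    [NormedAlgebra ℚ_[p] K] [IsUltrametricDist K]
    (f : ℤ_[p] → K) (hf : Continuous f) :
    Filter.Tendsto
      (fun l : ℕ => ∑ a ∈ Finset.range (p ^ l),
        (-1 : K) ^ a * (f ((a : ℤ_[p]) + 1) + f (a : ℤ_[p])))
      Filter.atTop (nhds (2 * f 0)) := by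
  have key : ∀ n : ℕ, ∑ a ∈ Finset.range n,
      (-1 : K) ^ a * (f ((a : ℤ_[p]) + 1) + f (a : ℤ_[p])) = f 0 - (-1) ^ n * f (n : ℤ_[p]) := by
    intro n
    induction n with
    | zero => simp
    | succ k ih =>
      rw [Finset.sum_range_succ, ih]
      push_cast
      ring
  have hodd : Odd p := (Fact.out : p.Prime).odd_of_ne_two hp
  have hlim : Filter.Tendsto (fun l : ℕ => (p : ℤ_[p]) ^ l) Filter.atTop (nhds 0) := by
    apply tendsto_pow_atTop_nhds_zero_of_norm_lt_one
    rw [PadicInt.norm_p]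
    exact inv_lt_one_of_one_lt₀ (by exact_mod_cast (Fact.out : p.Prime).one_lt)
  have h2 := (tendsto_const_nhds (x := f 0)).add ((hf.tendsto 0).comp hlim)
  rw [two_mul]
  refine h2.congr fun l => ?_
  rw [key, (hodd.pow).neg_one_pow]
  simp
end

section
/- Let p be an odd prime and K as below, let f : ℤ_p → K be continuous, and let m be a positive odd integer. Then there exist L ∈ K and L₀,…,L_{m−1} ∈ K such that ∑_{a=0}^{p^l−1} (−1)^a·f(a) → L as l → ∞, for each j with 0 ≤ j < m one has ∑_{a=0}^{p^l−1} (−1)^a·f(j + m·a) → L_j as l → ∞, and L = ∑_{j=0}^{m−1} (−1)^j·L_j. -/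
theorem aux_reidx {K : Type*} [AddCommMonoid K] (g : ℕ → K) (x y : ℕ) :
    ∑ i ∈ Finset.range (x * y), g i
      = ∑ a ∈ Finset.range y, ∑ j ∈ Finset.range x, g (j + x * a) := by
  induction y with
  | zero => simp
  | succ y ih =>
    rw [Nat.mul_succ, Finset.sum_range_add, Finset.sum_range_succ, ih]
    congr 1
    exact Finset.sum_congr rfl fun j _ => by rw [add_comm]

theorem aux_alt {K : Type*} [Ring K] {n : ℕ} (hn : Odd n) :
    ∑ c ∈ Finset.range n, (-1 : K) ^ c = 1 := by
  obtain ⟨k, rfl⟩ := hn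
  induction k with
  | zero => simp
  | succ k ih =>
    rw [show 2 * (k + 1) + 1 = (2 * k + 1) + 1 + 1 by ring, Finset.sum_range_succ,
      Finset.sum_range_succ, ih, pow_succ (-1 : K) (2 * k + 1)]
    simp

theorem aux_key (p : ℕ) [Fact p.Prime] (hp : p ≠ 2)
    (K : Type*) [NontriviallyNormedField K] [IsUltrametricDist K]
    (f : ℤ_[p] → K) (hf : Continuous f) (ε : ℝ) (hε : 0 < ε) :
    ∃ N : ℕ, ∀ l ≥ N, ∀ n : ℕ, Odd n →
      ‖∑ a ∈ Finset.range (p ^ l * n), (-1 : K) ^ a * f (a : ℤ_[p])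
        - ∑ a ∈ Finset.range (p ^ l), (-1 : K) ^ a * f (a : ℤ_[p])‖ < ε := by
  have huc := CompactSpace.uniformContinuous_of_continuous hf
  obtain ⟨δ, hδ, h⟩ := Metric.uniformContinuous_iff.1 huc (ε / 2) (by positivity)
  obtain ⟨N, hN⟩ := PadicInt.exists_pow_neg_lt p hδ
  refine ⟨N, fun l hl n hn => ?_⟩
  have hpo : Odd (p ^ l) := ((Fact.out : p.Prime).odd_of_ne_two hp).pow
  have e : ∑ a ∈ Finset.range (p ^ l * n), (-1 : K) ^ a * f (a : ℤ_[p])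
        - ∑ a ∈ Finset.range (p ^ l), (-1 : K) ^ a * f (a : ℤ_[p])
      = ∑ c ∈ Finset.range n, ∑ a ∈ Finset.range (p ^ l), (-1 : K) ^ c * (-1 : K) ^ a *
          (f ((a + p ^ l * c : ℕ) : ℤ_[p]) - f (a : ℤ_[p])) := by
    rw [aux_reidx]
    have : ∑ a ∈ Finset.range (p ^ l), (-1 : K) ^ a * f (a : ℤ_[p]) =
      ∑ c ∈ Finset.range n, ∑ a ∈ Finset.range (p ^ l), (-1 : K) ^ c * ((-1 : K) ^ a *
          f (a : ℤ_[p])) := by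
      simp_rw [← Finset.mul_sum]
      rw [← Finset.sum_mul, aux_alt hn, one_mul]
    rw [this, ← Finset.sum_sub_distrib]
    refine Finset.sum_congr rfl fun c _ => ?_
    rw [← Finset.sum_sub_distrib]
    refine Finset.sum_congr rfl fun a _ => ?_
    rw [pow_add, pow_mul, hpo.neg_one_pow]
    ring
  rw [e]
  refine lt_of_le_of_lt ?_ (half_lt_self hε)
  refine IsUltrametricDist.norm_sum_le_of_forall_le_of_nonneg (by positivity) fun c _ => ?_
  refine IsUltrametricDist.norm_sum_le_of_forall_le_of_nonneg (by positivity) fun a _ => ?_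
  rw [norm_mul, norm_mul, norm_pow, norm_pow, norm_neg, norm_one, one_pow, one_pow, one_mul,
    one_mul, ← dist_eq_norm]
  refine (h ?_).le
  rw [dist_eq_norm]
  push_cast
  rw [add_sub_cancel_left, norm_mul, PadicInt.norm_p_pow]
  refine lt_of_le_of_lt ?_ hN
  refine (mul_le_of_le_one_right (by positivity) (PadicInt.norm_le_one _)).trans ?_
  exact zpow_le_zpow_right₀ (by exact_mod_cast (Fact.out : p.Prime).one_le) (by omega)

theorem aux_conv (p : ℕ) [Fact p.Prime] (hp : p ≠ 2)
    (K : Type*) [NontriviallyNormedField K] [CompleteSpace K] [IsUltrametricDist K]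
    (f : ℤ_[p] → K) (hf : Continuous f) :
    ∃ L : K, Filter.Tendsto
        (fun l : ℕ => ∑ a ∈ Finset.range (p ^ l), (-1 : K) ^ a * f (a : ℤ_[p]))
        Filter.atTop (nhds L) := by
  apply cauchySeq_tendsto_of_complete
  rw [Metric.cauchySeq_iff']
  intro ε hε
  obtain ⟨N, hN⟩ := aux_key p hp K f hf ε hε
  refine ⟨N, fun n hn => ?_⟩
  have := hN N le_rfl (p ^ (n - N)) ((Fact.out : p.Prime).odd_of_ne_two hp).pow
  rw [← pow_add, Nat.add_sub_cancel' hn] at this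
  rwa [dist_eq_norm]


/-- For an odd prime `p`, a complete nontrivially normed ultrametric
field `K` which is a normed `ℚ_[p]`-algebra, a continuous `f : ℤ_p → K` and a positive odd
integer `m`, there exist `L ∈ K` and `L₀,…,L_{m−1} ∈ K` with
`∑_{a=0}^{p^l−1} (−1)^a f(a) → L`, `∑_{a=0}^{p^l−1} (−1)^a f(j+ma) → L_j` for `0 ≤ j < m`,
and `L = ∑_{j=0}^{m−1} (−1)^j L_j`. -/
theorem stmt14 (p : ℕ) [Fact p.Prime] (hp : p ≠ 2)
    (K : Type*) [NontriviallyNormedField K] [CompleteSpace K]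
    [NormedAlgebra ℚ_[p] K] [IsUltrametricDist K]
    (f : ℤ_[p] → K) (hf : Continuous f) (m : ℕ) (hm : 0 < m) (hmo : Odd m) :
    ∃ (L : K) (Lj : ℕ → K),
      Filter.Tendsto
        (fun l : ℕ => ∑ a ∈ Finset.range (p ^ l), (-1 : K) ^ a * f (a : ℤ_[p]))
        Filter.atTop (nhds L) ∧
      (∀ j < m, Filter.Tendsto
        (fun l : ℕ => ∑ a ∈ Finset.range (p ^ l),
          (-1 : K) ^ a * f ((j : ℤ_[p]) + (m : ℤ_[p]) * (a : ℤ_[p])))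
        Filter.atTop (nhds (Lj j))) ∧
      L = ∑ j ∈ Finset.range m, (-1 : K) ^ j * Lj j := by
  obtain ⟨L, hL⟩ := aux_conv p hp K f hf
  have hc : ∀ j : ℕ, ∃ L : K, Filter.Tendsto
        (fun l : ℕ => ∑ a ∈ Finset.range (p ^ l),
          (-1 : K) ^ a * f ((j : ℤ_[p]) + (m : ℤ_[p]) * (a : ℤ_[p])))
        Filter.atTop (nhds L) := fun j =>
    aux_conv p hp K (fun x => f ((j : ℤ_[p]) + (m : ℤ_[p]) * x)) (by fun_prop)
  choose Lj hLj using hc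
  refine ⟨L, Lj, hL, fun j _ => hLj j, ?_⟩
  have h1 : Filter.Tendsto
      (fun l : ℕ => ∑ a ∈ Finset.range (p ^ l * m), (-1 : K) ^ a * f (a : ℤ_[p]))
      Filter.atTop (nhds L) := by
    have h0 : Filter.Tendsto
      (fun l : ℕ => ∑ a ∈ Finset.range (p ^ l * m), (-1 : K) ^ a * f (a : ℤ_[p])
        - ∑ a ∈ Finset.range (p ^ l), (-1 : K) ^ a * f (a : ℤ_[p]))
      Filter.atTop (nhds 0) := by
      rw [Metric.tendsto_atTop]
      intro ε hε
      obtain ⟨N, hN⟩ := aux_key p hp K f hf ε hε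
      refine ⟨N, fun l hl => ?_⟩
      rw [dist_zero_right]
      exact hN l hl m hmo
    simpa using h0.add hL
  have h2 := tendsto_finsetSum (Finset.range m) fun j _ => (hLj j).const_mul ((-1 : K) ^ j)
  refine tendsto_nhds_unique h1 (h2.congr fun l => ?_)
  rw [mul_comm, aux_reidx, Finset.sum_comm]
  refine Finset.sum_congr rfl fun j _ => ?_
  rw [Finset.mul_sum]
  refine Finset.sum_congr rfl fun a _ => ?_
  rw [pow_add, pow_mul, hmo.neg_one_pow]
  push_cast
  ring
end
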